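/- Let X be a scheme of finite type over a field k and let S be any set of points of the underlying topological space of X. Then there exists a countable subset S' ⊆ S whose Zariski closure in X equals the Zariski closure of S. -/

import Mathlib

universe u

open AlgebraicGeometry CategoryTheory

/-- An algebra of finite type is spanned, as a module, by a countable set. -/
theorem Algebra.FiniteType.exists_countable_span_eq_top (R A : Type*) [CommSemiring R]
    [CommSemiring A] [Algebra R A] [Algebra.FiniteType R A] :
    ∃ G : Set A, G.Countable ∧ Submodule.span R G = ⊤ := by
  obtain ⟨s, hs⟩ := Algebra.FiniteType.out (R := R) (A := A)
  refine ⟨Submonoid.closure (s : Set A), ?_, ?_⟩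
  · have : Countable (FreeMonoid (s : Set A)) := inferInstanceAs (Countable (List _))
    rw [Submonoid.closure_eq_mrange]
    exact Set.countable_range _
  · rw [← Algebra.adjoin_eq_span, hs, Algebra.top_toSubmodule]

/-- In the spectrum of an algebra of finite type over a field, every set of points is contained in
the closure of one of its countable subsets. -/
theorem PrimeSpectrum.exists_countable_subset_subset_closure {k A : Type*} [Field k] [CommRing A]
    [Algebra k A] [Algebra.FiniteType k A] (S : Set (PrimeSpectrum A)) :
    ∃ S' ⊆ S, S'.Countable ∧ S ⊆ closure S' := by
  obtain ⟨G, hGc, hG⟩ := Algebra.FiniteType.exists_countable_span_eq_top k A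
  have key (F : Finset A) : ∃ T : Finset S, ∀ x : S, ∀ a ∈ Submodule.span k (F : Set A),
      (∀ y ∈ T, a ∈ y.1.asIdeal) → a ∈ x.1.asIdeal := by
    let V := Submodule.span k (F : Set A)
    obtain ⟨T, hT⟩ := Finset.exists_inf_le
      (fun x : S ↦ (x.1.asIdeal.restrictScalars k).comap V.subtype)
    exact ⟨T, fun x a ha h ↦ @hT x ⟨a, ha⟩ (Submodule.mem_finsetInf.mpr h)⟩
  choose T hT using key
  refine ⟨⋃ F ∈ {F : Finset A | (F : Set A) ⊆ G}, (Subtype.val '' (T F : Set S)), ?_, ?_, ?_⟩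
  · simp only [Set.iUnion_subset_iff]
    rintro F - _ ⟨y, -, rfl⟩
    exact y.2
  · refine Set.Countable.biUnion ?_ fun F _ ↦ (T F).countable_toSet.image _
    refine ((Set.countable_ofPred_finite_subset hGc).preimage_of_injOn
      Finset.coe_injective.injOn).mono fun F hF ↦ ?_
    exact And.intro F.finite_toSet hF
  · intro x hx
    rw [← zeroLocus_vanishingIdeal_eq_closure, mem_zeroLocus]
    intro a ha
    obtain ⟨F, hFG, haF⟩ := Submodule.mem_span_finite_of_mem_span (hG ▸ Submodule.mem_top : a ∈ _)
    refine hT F ⟨x, hx⟩ a haF fun y hy ↦ ?_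
    exact (mem_vanishingIdeal _ _).mp ha y <| Set.mem_biUnion hFG ⟨y, hy, rfl⟩

/-- **Countable subcollection with the same Zariski closure (Claim in Corollary 6.2).**
Let `X` be a scheme of finite type over a field `k` and let `S` be any set of points of the
underlying topological space of `X`.  Then there exists a countable subset `S' ⊆ S` whose
Zariski closure in `X` equals the Zariski closure of `S`. -/
theorem exists_countable_subset_with_same_closure
    {k : Type u} [Field k] (X : Scheme.{u}) (sX : X ⟶ Spec (CommRingCat.of k))
    [LocallyOfFiniteType sX] [QuasiCompact sX]
    (S : Set X) :
    ∃ S' ⊆ S, S'.Countable ∧ closure S' = closure S := by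
  have : CompactSpace X := QuasiCompact.compactSpace_of_compactSpace sX
  let 𝒰 := X.affineOpenCover.openCover.finiteSubcover
  have key (i : 𝒰.I₀) : ∃ T ⊆ 𝒰.f i ⁻¹' S, T.Countable ∧ 𝒰.f i ⁻¹' S ⊆ closure T := by
    obtain ⟨φ, hφ⟩ := Spec.map_surjective (𝒰.f i ≫ sX)
    have hft : LocallyOfFiniteType (Spec.map φ) := by
      have : IsOpenImmersion (𝒰.f i) := 𝒰.map_prop i
      have : LocallyOfFiniteType (𝒰.f i) := locallyOfFiniteType_of_isOpenImmersion _
      exact hφ ▸ locallyOfFiniteType_comp (𝒰.f i) sX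
    have hφ' : φ.hom.FiniteType := HasRingHomProperty.Spec_iff.mp hft
    algebraize [φ.hom]
    exact PrimeSpectrum.exists_countable_subset_subset_closure (k := k) _
  choose T hTS hTc hT using key
  have hsub : ⋃ i, 𝒰.f i '' T i ⊆ S := Set.iUnion_subset fun i ↦ Set.image_subset_iff.mpr (hTS i)
  refine ⟨⋃ i, 𝒰.f i '' T i, hsub, Set.countable_iUnion fun i ↦ (hTc i).image _,
    (closure_mono hsub).antisymm (closure_minimal (fun x hx ↦ ?_) isClosed_closure)⟩
  obtain ⟨i, y, rfl⟩ := 𝒰.exists_eq x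
  exact closure_mono (Set.subset_iUnion (fun i ↦ 𝒰.f i '' T i) i) <|
    image_closure_subset_closure_image (𝒰.f i).continuous ⟨y, hT i hx, rfl⟩
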